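/- Under the generalized β-conformal change L̄(y) = f(e^σ·L(y), β(y)), the transformed (h)hv-torsion tensor C̄^l_{ij} := ḡ^{lr}·C̄_{rij} (summation over r) satisfies, at every y ∈ Ω and for all indices l, i, j: C̄^l_{ij} = C^l_{ij} + M^l_{ij}, where C^l_{ij} = g^{lr}·C_{rij} and M^l_{ij} = (1/(2p))·[e^{−σ}·mˡ − p·m²·(s₀·bˡ + s₋₁·yˡ)]·(e^σ·p₋₁·h_{ij} + p₀₂·m_i·m_j) − e^σ·(s₀·bˡ + s₋₁·yˡ)·(p·C_{isj}·bˢ + p₋₁·m_i·m_j) + (p₋₁/(2p))·(hˡ_i·m_j + hˡ_j·m_i), with mˡ = g^{lr}·m_r, hˡ_i = g^{lr}·h_{ri}, and ḡ^{lr} = (e^{−σ}/p)·g^{lr} − s₀·bˡ·bʳ − s₋₁·(yˡ·bʳ + yʳ·bˡ) − s₋₂·yˡ·yʳ the inverse of the transformed metric ḡ_{ij} = (1/2)·∂²(L̄²)/∂yⁱ∂yʲ. -/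

import Mathlib

open Real

noncomputable section

/-- Partial derivative of `f : ℝ × ℝ → ℝ` with respect to its first argument. -/
def pds (f : ℝ × ℝ → ℝ) (x : ℝ × ℝ) : ℝ := fderiv ℝ f x (1, 0)

/-- Partial derivative of `f : ℝ × ℝ → ℝ` with respect to its second argument. -/
def pdt (f : ℝ × ℝ → ℝ) (x : ℝ × ℝ) : ℝ := fderiv ℝ f x (0, 1)

/-- Partial derivative with respect to the i-th coordinate `yⁱ`. -/
def pdi {n : ℕ} (F : (Fin n → ℝ) → ℝ) (i : Fin n) (y : Fin n → ℝ) : ℝ :=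
  fderiv ℝ F y (Pi.single i 1)

/-- Finsler metric tensor g_{ij} = (1/2)·∂²(L²)/∂yⁱ∂yʲ. -/
def gmet {n : ℕ} (L : (Fin n → ℝ) → ℝ) (y : Fin n → ℝ) (i j : Fin n) : ℝ :=
  (1 / 2) * pdi (pdi (fun w => (L w) ^ 2) i) j y

/-- Normalized supporting element l_i = ∂L/∂yⁱ. -/
def lvec {n : ℕ} (L : (Fin n → ℝ) → ℝ) (y : Fin n → ℝ) (i : Fin n) : ℝ := pdi L i y

/-- y_i = g_{ij}·yʲ. -/
def ylow {n : ℕ} (L : (Fin n → ℝ) → ℝ) (y : Fin n → ℝ) (i : Fin n) : ℝ :=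
  ∑ j, gmet L y i j * y j

/-- Angular metric tensor h_{ij} = g_{ij} − l_i·l_j. -/
def hmet {n : ℕ} (L : (Fin n → ℝ) → ℝ) (y : Fin n → ℝ) (i j : Fin n) : ℝ :=
  gmet L y i j - lvec L y i * lvec L y j

/-- Cartan tensor C_{ijk} = (1/4)·∂³(L²)/∂yⁱ∂yʲ∂yᵏ. -/
def cartan {n : ℕ} (L : (Fin n → ℝ) → ℝ) (y : Fin n → ℝ) (i j k : Fin n) : ℝ :=
  (1 / 4) * pdi (pdi (pdi (fun w => (L w) ^ 2) i) j) k y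

/-- β(y) = b_i·yⁱ. -/
def betaf {n : ℕ} (b : Fin n → ℝ) (y : Fin n → ℝ) : ℝ := ∑ i, b i * y i

/-- m_i = b_i − (β/L²)·y_i. -/
def mvec {n : ℕ} (L : (Fin n → ℝ) → ℝ) (b : Fin n → ℝ) (y : Fin n → ℝ) (i : Fin n) : ℝ :=
  b i - (betaf b y / (L y) ^ 2) * ylow L y i

/-- The evaluation point (e^σ·L(y), β(y)). -/
def basept {n : ℕ} (L : (Fin n → ℝ) → ℝ) (b : Fin n → ℝ) (σ : ℝ) (y : Fin n → ℝ) : ℝ × ℝ :=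
  (Real.exp σ * L y, betaf b y)

/-- q = f·f₂ evaluated at (e^σ·L(y), β(y)). -/
def qfun {n : ℕ} (f : ℝ × ℝ → ℝ) (L : (Fin n → ℝ) → ℝ) (b : Fin n → ℝ) (σ : ℝ)
    (y : Fin n → ℝ) : ℝ :=
  f (basept L b σ y) * pdt f (basept L b σ y)

/-- p = f·f₁/L evaluated at (e^σ·L(y), β(y)). -/
def pfun {n : ℕ} (f : ℝ × ℝ → ℝ) (L : (Fin n → ℝ) → ℝ) (b : Fin n → ℝ) (σ : ℝ)
    (y : Fin n → ℝ) : ℝ :=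
  f (basept L b σ y) * pds f (basept L b σ y) / L y

/-- q₀ = f·f₂₂ evaluated at (e^σ·L(y), β(y)). -/
def q0fun {n : ℕ} (f : ℝ × ℝ → ℝ) (L : (Fin n → ℝ) → ℝ) (b : Fin n → ℝ) (σ : ℝ)
    (y : Fin n → ℝ) : ℝ :=
  f (basept L b σ y) * pdt (pdt f) (basept L b σ y)

/-- p₀ = f₂² + q₀ evaluated at (e^σ·L(y), β(y)). -/
def p0fun {n : ℕ} (f : ℝ × ℝ → ℝ) (L : (Fin n → ℝ) → ℝ) (b : Fin n → ℝ) (σ : ℝ)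
    (y : Fin n → ℝ) : ℝ :=
  (pdt f (basept L b σ y)) ^ 2 + q0fun f L b σ y

/-- q₋₁ = f·f₁₂/L evaluated at (e^σ·L(y), β(y)). -/
def qm1fun {n : ℕ} (f : ℝ × ℝ → ℝ) (L : (Fin n → ℝ) → ℝ) (b : Fin n → ℝ) (σ : ℝ)
    (y : Fin n → ℝ) : ℝ :=
  f (basept L b σ y) * pdt (pds f) (basept L b σ y) / L y

/-- p₋₁ = q₋₁ + p·f₂/f evaluated at (e^σ·L(y), β(y)). -/
def pm1fun {n : ℕ} (f : ℝ × ℝ → ℝ) (L : (Fin n → ℝ) → ℝ) (b : Fin n → ℝ) (σ : ℝ)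
    (y : Fin n → ℝ) : ℝ :=
  qm1fun f L b σ y + pfun f L b σ y * pdt f (basept L b σ y) / f (basept L b σ y)

/-- q₋₂ = f·(e^σ·f₁₁ − f₁/L)/L² evaluated at (e^σ·L(y), β(y)). -/
def qm2fun {n : ℕ} (f : ℝ × ℝ → ℝ) (L : (Fin n → ℝ) → ℝ) (b : Fin n → ℝ) (σ : ℝ)
    (y : Fin n → ℝ) : ℝ :=
  f (basept L b σ y) *
    (Real.exp σ * pds (pds f) (basept L b σ y) - pds f (basept L b σ y) / L y) / (L y) ^ 2

/-- p₋₂ = q₋₂ + e^σ·p²/f² evaluated at (e^σ·L(y), β(y)). -/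
def pm2fun {n : ℕ} (f : ℝ × ℝ → ℝ) (L : (Fin n → ℝ) → ℝ) (b : Fin n → ℝ) (σ : ℝ)
    (y : Fin n → ℝ) : ℝ :=
  qm2fun f L b σ y + Real.exp σ * (pfun f L b σ y) ^ 2 / (f (basept L b σ y)) ^ 2

/-- p₀₂ = ∂(f₂² + f·f₂₂)/∂t evaluated at (e^σ·L(y), β(y)). -/
def p02fun {n : ℕ} (f : ℝ × ℝ → ℝ) (L : (Fin n → ℝ) → ℝ) (b : Fin n → ℝ) (σ : ℝ)
    (y : Fin n → ℝ) : ℝ :=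
  pdt (fun x => (pdt f x) ^ 2 + f x * pdt (pdt f) x) (basept L b σ y)

/-- The transformed Finsler function L̄(y) = f(e^σ·L(y), β(y)). -/
def Lbar {n : ℕ} (f : ℝ × ℝ → ℝ) (L : (Fin n → ℝ) → ℝ) (b : Fin n → ℝ) (σ : ℝ)
    (y : Fin n → ℝ) : ℝ :=
  f (basept L b σ y)

/-- bⁱ = g^{ij}·b_j. -/
def bup {n : ℕ} (ginv : (Fin n → ℝ) → Fin n → Fin n → ℝ) (b : Fin n → ℝ)
    (y : Fin n → ℝ) (i : Fin n) : ℝ :=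
  ∑ j, ginv y i j * b j

/-- b² = g^{ij}·b_i·b_j. -/
def bsq {n : ℕ} (ginv : (Fin n → ℝ) → Fin n → Fin n → ℝ) (b : Fin n → ℝ)
    (y : Fin n → ℝ) : ℝ :=
  ∑ i, ∑ j, ginv y i j * b i * b j

/-- m² = g^{ij}·m_i·m_j. -/
def msq {n : ℕ} (L : (Fin n → ℝ) → ℝ) (ginv : (Fin n → ℝ) → Fin n → Fin n → ℝ)
    (b : Fin n → ℝ) (y : Fin n → ℝ) : ℝ :=
  ∑ i, ∑ j, ginv y i j * mvec L b y i * mvec L b y j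

/-- mⁱ = g^{ij}·m_j. -/
def mup {n : ℕ} (L : (Fin n → ℝ) → ℝ) (ginv : (Fin n → ℝ) → Fin n → Fin n → ℝ)
    (b : Fin n → ℝ) (y : Fin n → ℝ) (i : Fin n) : ℝ :=
  ∑ j, ginv y i j * mvec L b y j

/-- hⁱ_j = g^{ir}·h_{rj}. -/
def hup {n : ℕ} (L : (Fin n → ℝ) → ℝ) (ginv : (Fin n → ℝ) → Fin n → Fin n → ℝ)
    (y : Fin n → ℝ) (i j : Fin n) : ℝ :=
  ∑ r, ginv y i r * hmet L y r j

/-- ε = f²·(e^σ·p + m²·q₀)/L². -/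
def epsfun {n : ℕ} (f : ℝ × ℝ → ℝ) (L : (Fin n → ℝ) → ℝ)
    (ginv : (Fin n → ℝ) → Fin n → Fin n → ℝ) (b : Fin n → ℝ) (σ : ℝ) (y : Fin n → ℝ) : ℝ :=
  (f (basept L b σ y)) ^ 2 *
    (Real.exp σ * pfun f L b σ y + msq L ginv b y * q0fun f L b σ y) / (L y) ^ 2

/-- s₀ = e^{−σ}·f²·q₀/(ε·p·L²). -/
def s0fun {n : ℕ} (f : ℝ × ℝ → ℝ) (L : (Fin n → ℝ) → ℝ)
    (ginv : (Fin n → ℝ) → Fin n → Fin n → ℝ) (b : Fin n → ℝ) (σ : ℝ) (y : Fin n → ℝ) : ℝ :=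
  Real.exp (-σ) * (f (basept L b σ y)) ^ 2 * q0fun f L b σ y /
    (epsfun f L ginv b σ y * pfun f L b σ y * (L y) ^ 2)

/-- s₋₁ = p₋₁·f²/(ε·p·L²). -/
def sm1fun {n : ℕ} (f : ℝ × ℝ → ℝ) (L : (Fin n → ℝ) → ℝ)
    (ginv : (Fin n → ℝ) → Fin n → Fin n → ℝ) (b : Fin n → ℝ) (σ : ℝ) (y : Fin n → ℝ) : ℝ :=
  pm1fun f L b σ y * (f (basept L b σ y)) ^ 2 /
    (epsfun f L ginv b σ y * pfun f L b σ y * (L y) ^ 2)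

/-- s₋₂ = p₋₁·(e^σ·m²·p·L² − b²·f²)/(ε·p·β·L²). -/
def sm2fun {n : ℕ} (f : ℝ × ℝ → ℝ) (L : (Fin n → ℝ) → ℝ)
    (ginv : (Fin n → ℝ) → Fin n → Fin n → ℝ) (b : Fin n → ℝ) (σ : ℝ) (y : Fin n → ℝ) : ℝ :=
  pm1fun f L b σ y *
    (Real.exp σ * msq L ginv b y * pfun f L b σ y * (L y) ^ 2 -
      bsq ginv b y * (f (basept L b σ y)) ^ 2) /
    (epsfun f L ginv b σ y * pfun f L b σ y * betaf b y * (L y) ^ 2)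

/-- ḡ^{ij} = (e^{−σ}/p)·g^{ij} − s₀·bⁱ·bʲ − s₋₁·(yⁱ·bʲ + yʲ·bⁱ) − s₋₂·yⁱ·yʲ. -/
def gbarinv {n : ℕ} (f : ℝ × ℝ → ℝ) (L : (Fin n → ℝ) → ℝ)
    (ginv : (Fin n → ℝ) → Fin n → Fin n → ℝ) (b : Fin n → ℝ) (σ : ℝ) (y : Fin n → ℝ)
    (i j : Fin n) : ℝ :=
  (Real.exp (-σ) / pfun f L b σ y) * ginv y i j
    - s0fun f L ginv b σ y * bup ginv b y i * bup ginv b y j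
    - sm1fun f L ginv b σ y * (y i * bup ginv b y j + y j * bup ginv b y i)
    - sm2fun f L ginv b σ y * y i * y j

section DirectionalDerivative

variable {E : Type*} [NormedAddCommGroup E] [NormedSpace ℝ E]

/-- `F` is differentiable at `x`, with derivative `d` in the direction `v`. -/
def HasDirDeriv (F : E → ℝ) (v x : E) (d : ℝ) : Prop :=
  DifferentiableAt ℝ F x ∧ fderiv ℝ F x v = d

theorem HasDirDeriv.add {F G : E → ℝ} {v x : E} {c d : ℝ}
    (hF : HasDirDeriv F v x c) (hG : HasDirDeriv G v x d) :
    HasDirDeriv (fun z => F z + G z) v x (c + d) := by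
  refine ⟨hF.1.add hG.1, ?_⟩
  rw [fderiv_fun_add hF.1 hG.1, ← hF.2, ← hG.2]
  rfl

theorem HasDirDeriv.mul {F G : E → ℝ} {v x : E} {c d : ℝ}
    (hF : HasDirDeriv F v x c) (hG : HasDirDeriv G v x d) :
    HasDirDeriv (fun z => F z * G z) v x (c * G x + F x * d) := by
  refine ⟨hF.1.mul hG.1, ?_⟩
  rw [fderiv_fun_mul hF.1 hG.1, ← hF.2, ← hG.2]
  simp only [add_apply, smul_apply, smul_eq_mul]
  ring

theorem HasDirDeriv.const_mul {F : E → ℝ} {v x : E} {d : ℝ} (c : ℝ)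
    (hF : HasDirDeriv F v x d) : HasDirDeriv (fun z => c * F z) v x (c * d) := by
  refine ⟨hF.1.const_mul c, ?_⟩
  rw [fderiv_const_mul hF.1, ← hF.2]
  rfl

theorem HasDirDeriv.fderiv_eq_of_eqOn {F G : E → ℝ} {U : Set E} (hU : IsOpen U) {v x : E}
    {d : ℝ} (hG : HasDirDeriv G v x d) (h : Set.EqOn F G U) (hx : x ∈ U) :
    fderiv ℝ F x v = d := by
  rw [(h.eventuallyEq_of_mem (hU.mem_nhds hx)).fderiv_eq, hG.2]

theorem ContDiffOn.hasDirDeriv {F : E → ℝ} {U : Set E} (hF : ContDiffOn ℝ (⊤ : ℕ∞) F U)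
    (hU : IsOpen U) (v : E) {x : E} (hx : x ∈ U) : HasDirDeriv F v x (fderiv ℝ F x v) :=
  ⟨(hF.contDiffAt (hU.mem_nhds hx)).differentiableAt (by simp), rfl⟩

theorem ContDiffOn.fderiv_apply_const {F : E → ℝ} {U : Set E}
    (hF : ContDiffOn ℝ (⊤ : ℕ∞) F U) (hU : IsOpen U) (v : E) :
    ContDiffOn ℝ (⊤ : ℕ∞) (fun x => fderiv ℝ F x v) U :=
  (hF.fderiv_of_isOpen hU (by simp)).clm_apply contDiffOn_const

theorem ContDiffOn.fderiv_fderiv_comm {F : E → ℝ} {U : Set E}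
    (hF : ContDiffOn ℝ (⊤ : ℕ∞) F U) (hU : IsOpen U) (v w : E) {x : E} (hx : x ∈ U) :
    fderiv ℝ (fun z => fderiv ℝ F z v) x w = fderiv ℝ (fun z => fderiv ℝ F z w) x v := by
  have hd : DifferentiableAt ℝ (fderiv ℝ F) x :=
    ((hF.fderiv_of_isOpen (m := (⊤ : ℕ∞)) hU (by simp)).contDiffAt
      (hU.mem_nhds hx)).differentiableAt (by simp)
  have key (u : E) : fderiv ℝ (fun z => fderiv ℝ F z u) x
      = (fderiv ℝ (fderiv ℝ F) x).flip u := by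
    simpa using (hd.hasFDerivAt.clm_apply (hasFDerivAt_const u x)).fderiv
  rw [key, key]
  exact ((hF.contDiffAt (hU.mem_nhds hx)).isSymmSndFDerivAt (by
    rw [minSmoothness_of_isRCLikeNormedField]; exact WithTop.coe_le_coe.2 le_top)) w v

/-- `F` is positively homogeneous of integer degree `k` on `U`. -/
def IsHomogeneousOn (F : E → ℝ) (U : Set E) (k : ℤ) : Prop :=
  ∀ c : ℝ, 0 < c → ∀ x ∈ U, F (c • x) = c ^ k * F x

theorem IsHomogeneousOn.sq {F : E → ℝ} {U : Set E} (h : IsHomogeneousOn F U 1) :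
    IsHomogeneousOn (fun w => F w ^ 2) U 2 := by
  intro c hc x hx
  simp only [h c hc x hx, zpow_one, mul_pow]
  rfl

theorem IsHomogeneousOn.fderiv_self {F : E → ℝ} {U : Set E} {k : ℤ}
    (h : IsHomogeneousOn F U k) (hF : ContDiffOn ℝ (⊤ : ℕ∞) F U) (hU : IsOpen U)
    {x : E} (hx : x ∈ U) : fderiv ℝ F x x = k * F x := by
  have hFx : HasFDerivAt F (fderiv ℝ F x) ((1 : ℝ) • x) := by
    rw [one_smul]; exact (hF.hasDirDeriv hU x hx).1.hasFDerivAt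
  have h1 : HasDerivAt (fun c : ℝ => F (c • x)) (fderiv ℝ F x ((1 : ℝ) • x)) 1 :=
    hFx.comp_hasDerivAt (1 : ℝ) ((hasDerivAt_id (1 : ℝ)).smul_const x)
  have h2 : HasDerivAt (fun c : ℝ => c ^ k * F x) (k * (1 : ℝ) ^ (k - 1) * F x) 1 :=
    (hasDerivAt_zpow k 1 (Or.inl one_ne_zero)).mul_const _
  have h3 : (fun c : ℝ => F (c • x)) =ᶠ[nhds 1] fun c : ℝ => c ^ k * F x := by
    filter_upwards [lt_mem_nhds (zero_lt_one' ℝ)] with c hc using h c hc x hx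
  simpa using (h1.congr_of_eventuallyEq h3.symm).unique h2

theorem IsHomogeneousOn.fderiv_apply {F : E → ℝ} {U : Set E} {k : ℤ}
    (h : IsHomogeneousOn F U k) (hF : ContDiffOn ℝ (⊤ : ℕ∞) F U) (hU : IsOpen U)
    (hcone : ∀ c : ℝ, 0 < c → ∀ x ∈ U, c • x ∈ U) (v : E) :
    IsHomogeneousOn (fun x => fderiv ℝ F x v) U (k - 1) := by
  intro c hc x hx
  have h1 : HasFDerivAt (fun z : E => F (c • z))
      ((fderiv ℝ F (c • x)).comp (c • ContinuousLinearMap.id ℝ E)) x :=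
    (hF.hasDirDeriv hU x (hcone c hc x hx)).1.hasFDerivAt.comp x
      ((hasFDerivAt_id x).const_smul c)
  have h2 : HasFDerivAt (fun z : E => c ^ k * F z) (c ^ k • fderiv ℝ F x) x :=
    (hF.hasDirDeriv hU x hx).1.hasFDerivAt.const_mul _
  have h3 : (fun z : E => F (c • z)) =ᶠ[nhds x] fun z : E => c ^ k * F z := by
    filter_upwards [hU.mem_nhds hx] with z hz using h c hc z hz
  have h4 := DFunLike.congr_fun ((h1.congr_of_eventuallyEq h3.symm).unique h2) v
  simp only [ContinuousLinearMap.comp_apply, smul_apply,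
    ContinuousLinearMap.id_apply, map_smul, smul_eq_mul] at h4
  rw [zpow_sub_one₀ hc.ne']
  field_simp
  linarith

end DirectionalDerivative

section Finsler

variable {n : ℕ} {Ω : Set (Fin n → ℝ)} {L : (Fin n → ℝ) → ℝ}

theorem sum_pdi_mul_apply (F : (Fin n → ℝ) → ℝ) (y : Fin n → ℝ) :
    ∑ i, pdi F i y * y i = fderiv ℝ F y y := by
  conv_rhs => rw [← Finset.univ_sum_single y, map_sum]
  refine Finset.sum_congr rfl fun i _ => ?_
  have h : (Pi.single i (y i) : Fin n → ℝ) = y i • Pi.single i 1 := by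
    rw [← Pi.single_smul, smul_eq_mul, mul_one]
  rw [h, map_smul, smul_eq_mul, mul_comm, Finset.univ_sum_single]
  rfl

theorem IsHomogeneousOn.sum_pdi_mul {F : (Fin n → ℝ) → ℝ} {k : ℤ}
    (h : IsHomogeneousOn F Ω k) (hF : ContDiffOn ℝ (⊤ : ℕ∞) F Ω) (hΩ : IsOpen Ω)
    {y : Fin n → ℝ} (hy : y ∈ Ω) : ∑ i, pdi F i y * y i = k * F y := by
  rw [sum_pdi_mul_apply, h.fderiv_self hF hΩ hy]

theorem pdi_sq (hΩ : IsOpen Ω) (hL : ContDiffOn ℝ (⊤ : ℕ∞) L Ω) (i : Fin n) :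
    Set.EqOn (pdi (fun w => L w ^ 2) i) (fun z => 2 * (L z * pdi L i z)) Ω := by
  intro y hy
  have h := hL.hasDirDeriv hΩ (Pi.single i 1) hy
  exact (h.mul h).fderiv_eq_of_eqOn hΩ (fun z _ => sq (L z)) hy |>.trans
    (by simp only [pdi]; ring)

theorem pdi_pdi_sq (hΩ : IsOpen Ω) (hL : ContDiffOn ℝ (⊤ : ℕ∞) L Ω) (i j : Fin n) :
    Set.EqOn (pdi (pdi (fun w => L w ^ 2) i) j)
      (fun z => 2 * (pdi L j z * pdi L i z + L z * pdi (pdi L i) j z)) Ω := by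
  intro y hy
  exact (((hL.hasDirDeriv hΩ (Pi.single j 1) hy).mul
    ((hL.fderiv_apply_const hΩ (Pi.single i 1)).hasDirDeriv hΩ _ hy)).const_mul
      2).fderiv_eq_of_eqOn hΩ (pdi_sq hΩ hL i) hy

theorem gmet_eq (hΩ : IsOpen Ω) (hL : ContDiffOn ℝ (⊤ : ℕ∞) L Ω) {y : Fin n → ℝ}
    (hy : y ∈ Ω) (i j : Fin n) :
    gmet L y i j = pdi L i y * pdi L j y + L y * pdi (pdi L i) j y := by
  rw [gmet, pdi_pdi_sq hΩ hL i j hy]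
  ring

theorem hmet_eq (hΩ : IsOpen Ω) (hL : ContDiffOn ℝ (⊤ : ℕ∞) L Ω) {y : Fin n → ℝ}
    (hy : y ∈ Ω) (i j : Fin n) : hmet L y i j = L y * pdi (pdi L i) j y := by
  rw [hmet, gmet_eq hΩ hL hy, lvec, lvec]
  ring

theorem cartan_eq (hΩ : IsOpen Ω) (hL : ContDiffOn ℝ (⊤ : ℕ∞) L Ω) {y : Fin n → ℝ}
    (hy : y ∈ Ω) (i j k : Fin n) :
    cartan L y i j k = 1 / 2 * (pdi (pdi L i) j y * pdi L k y + pdi (pdi L i) k y * pdi L j y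
      + pdi (pdi L j) k y * pdi L i y + L y * pdi (pdi (pdi L i) j) k y) := by
  have h1 (a : Fin n) : ContDiffOn ℝ (⊤ : ℕ∞) (pdi L a) Ω :=
    hL.fderiv_apply_const hΩ (Pi.single a 1)
  have h2 : ContDiffOn ℝ (⊤ : ℕ∞) (pdi (pdi L i) j) Ω :=
    (h1 i).fderiv_apply_const hΩ (Pi.single j 1)
  have h : pdi (pdi (pdi (fun w => L w ^ 2) i) j) k y = _ :=
    ((((h1 j).hasDirDeriv hΩ (Pi.single k 1) hy).mul ((h1 i).hasDirDeriv hΩ _ hy)).add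
      ((hL.hasDirDeriv hΩ _ hy).mul (h2.hasDirDeriv hΩ _ hy))).const_mul 2
      |>.fderiv_eq_of_eqOn hΩ (pdi_pdi_sq hΩ hL i j) hy
  rw [cartan, h]
  simp only [pdi]
  ring

theorem pdi_pdi_comm (hΩ : IsOpen Ω) (hL : ContDiffOn ℝ (⊤ : ℕ∞) L Ω) {y : Fin n → ℝ}
    (hy : y ∈ Ω) (i j : Fin n) : pdi (pdi L i) j y = pdi (pdi L j) i y :=
  hL.fderiv_fderiv_comm hΩ _ _ hy

theorem gmet_comm (hΩ : IsOpen Ω) (hL : ContDiffOn ℝ (⊤ : ℕ∞) L Ω) {y : Fin n → ℝ}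
    (hy : y ∈ Ω) (i j : Fin n) : gmet L y i j = gmet L y j i := by
  rw [gmet, gmet, pdi_pdi_comm hΩ (hL.pow 2) hy]

theorem hmet_comm (hΩ : IsOpen Ω) (hL : ContDiffOn ℝ (⊤ : ℕ∞) L Ω) {y : Fin n → ℝ}
    (hy : y ∈ Ω) (i j : Fin n) : hmet L y i j = hmet L y j i := by
  rw [hmet, hmet, gmet_comm hΩ hL hy, mul_comm]

theorem cartan_comm_left (hΩ : IsOpen Ω) (hL : ContDiffOn ℝ (⊤ : ℕ∞) L Ω) {y : Fin n → ℝ}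
    (hy : y ∈ Ω) (i j k : Fin n) : cartan L y i j k = cartan L y j i k := by
  rw [cartan, cartan]
  congr 1
  exact HasDirDeriv.fderiv_eq_of_eqOn hΩ
    ((((hL.pow 2).fderiv_apply_const hΩ (Pi.single j 1)).fderiv_apply_const hΩ
      (Pi.single i 1)).hasDirDeriv hΩ (Pi.single k 1) hy)
    (fun z hz => pdi_pdi_comm hΩ (hL.pow 2) hz i j) hy

theorem cartan_comm_right (hΩ : IsOpen Ω) (hL : ContDiffOn ℝ (⊤ : ℕ∞) L Ω) {y : Fin n → ℝ}
    (hy : y ∈ Ω) (i j k : Fin n) : cartan L y i j k = cartan L y i k j := by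
  rw [cartan, cartan]
  congr 1
  exact pdi_pdi_comm hΩ ((hL.pow 2).fderiv_apply_const hΩ (Pi.single i 1)) hy j k

theorem ylow_eq (hΩ : IsOpen Ω) (hcone : ∀ c : ℝ, 0 < c → ∀ x ∈ Ω, c • x ∈ Ω)
    (hL : ContDiffOn ℝ (⊤ : ℕ∞) L Ω) (hhom : IsHomogeneousOn L Ω 1) {y : Fin n → ℝ}
    (hy : y ∈ Ω) (i : Fin n) : ylow L y i = L y * pdi L i y := by
  have h := (hhom.sq.fderiv_apply (hL.pow 2) hΩ hcone (Pi.single i 1)).sum_pdi_mul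
    ((hL.pow 2).fderiv_apply_const hΩ _) hΩ hy
  have h' := pdi_sq hΩ hL i hy
  change ∑ j, pdi (pdi (fun w => L w ^ 2) i) j y * y j
    = ((2 - 1 : ℤ) : ℝ) * pdi (fun w => L w ^ 2) i y at h
  simp only [ylow, gmet, mul_assoc, ← Finset.mul_sum]
  rw [h, h']
  push_cast
  ring

theorem sum_lvec_mul (hΩ : IsOpen Ω) (hL : ContDiffOn ℝ (⊤ : ℕ∞) L Ω)
    (hhom : IsHomogeneousOn L Ω 1) {y : Fin n → ℝ} (hy : y ∈ Ω) :
    ∑ i, pdi L i y * y i = L y := by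
  simpa using hhom.sum_pdi_mul hL hΩ hy

theorem sum_cartan_mul (hΩ : IsOpen Ω) (hcone : ∀ c : ℝ, 0 < c → ∀ x ∈ Ω, c • x ∈ Ω)
    (hL : ContDiffOn ℝ (⊤ : ℕ∞) L Ω) (hhom : IsHomogeneousOn L Ω 1) {y : Fin n → ℝ}
    (hy : y ∈ Ω) (i j : Fin n) : ∑ k, cartan L y i j k * y k = 0 := by
  have hs := (hL.pow 2).fderiv_apply_const hΩ (Pi.single i 1)
  have h := ((hhom.sq.fderiv_apply (hL.pow 2) hΩ hcone (Pi.single i 1)).fderiv_apply hs hΩ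
    hcone (Pi.single j 1)).sum_pdi_mul (hs.fderiv_apply_const hΩ _) hΩ hy
  simp only [cartan, mul_assoc, ← Finset.mul_sum]
  refine mul_eq_zero_of_right _ (h.trans ?_)
  norm_num

theorem sum_hmet_mul (hΩ : IsOpen Ω) (hcone : ∀ c : ℝ, 0 < c → ∀ x ∈ Ω, c • x ∈ Ω)
    (hL : ContDiffOn ℝ (⊤ : ℕ∞) L Ω) (hhom : IsHomogeneousOn L Ω 1) {y : Fin n → ℝ}
    (hy : y ∈ Ω) (i : Fin n) : ∑ j, hmet L y i j * y j = 0 := by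
  have h := ylow_eq hΩ hcone hL hhom hy i
  simp only [hmet, sub_mul, Finset.sum_sub_distrib, mul_assoc, ← Finset.mul_sum, lvec,
    sum_lvec_mul hΩ hL hhom hy]
  rw [ylow] at h
  rw [h]
  ring

theorem mvec_eq (hΩ : IsOpen Ω) (hcone : ∀ c : ℝ, 0 < c → ∀ x ∈ Ω, c • x ∈ Ω)
    (hL : ContDiffOn ℝ (⊤ : ℕ∞) L Ω) (hpos : ∀ y ∈ Ω, 0 < L y)
    (hhom : IsHomogeneousOn L Ω 1) (b : Fin n → ℝ) {y : Fin n → ℝ}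
    (hy : y ∈ Ω) (i : Fin n) : mvec L b y i = b i - betaf b y / L y * pdi L i y := by
  have := (hpos y hy).ne'
  rw [mvec, ylow_eq hΩ hcone hL hhom hy]
  field_simp

theorem sum_mvec_mul (hΩ : IsOpen Ω) (hcone : ∀ c : ℝ, 0 < c → ∀ x ∈ Ω, c • x ∈ Ω)
    (hL : ContDiffOn ℝ (⊤ : ℕ∞) L Ω) (hpos : ∀ y ∈ Ω, 0 < L y)
    (hhom : IsHomogeneousOn L Ω 1) (b : Fin n → ℝ) {y : Fin n → ℝ}
    (hy : y ∈ Ω) : ∑ i, mvec L b y i * y i = 0 := by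
  have := (hpos y hy).ne'
  simp only [mvec_eq hΩ hcone hL hpos hhom b hy, sub_mul, Finset.sum_sub_distrib, mul_assoc,
    ← Finset.mul_sum, sum_lvec_mul hΩ hL hhom hy]
  rw [betaf]
  field_simp
  ring

end Finsler

section HalfPlane

theorem isOpen_halfPlane : IsOpen {x : ℝ × ℝ | 0 < x.1} :=
  isOpen_lt continuous_const continuous_fst

theorem smul_mem_halfPlane (c : ℝ) (hc : 0 < c) (x : ℝ × ℝ) (hx : x ∈ {x : ℝ × ℝ | 0 < x.1}) :
    c • x ∈ {x : ℝ × ℝ | 0 < x.1} :=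
  mul_pos hc hx

theorem fderiv_apply_eq_pds_add_pdt (G : ℝ × ℝ → ℝ) (x v : ℝ × ℝ) :
    fderiv ℝ G x v = v.1 * pds G x + v.2 * pdt G x := by
  have h : v = v.1 • ((1 : ℝ), (0 : ℝ)) + v.2 • ((0 : ℝ), (1 : ℝ)) := by
    ext <;> simp
  conv_lhs => rw [h, map_add, map_smul, map_smul]
  rfl

variable {G : ℝ × ℝ → ℝ}

theorem IsHomogeneousOn.pds_add_pdt {k : ℤ} (h : IsHomogeneousOn G {x | 0 < x.1} k)
    (hG : ContDiffOn ℝ (⊤ : ℕ∞) G {x | 0 < x.1}) {x : ℝ × ℝ} (hx : 0 < x.1) :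
    x.1 * pds G x + x.2 * pdt G x = k * G x := by
  rw [← fderiv_apply_eq_pds_add_pdt, h.fderiv_self hG isOpen_halfPlane hx]

theorem ContDiffOn.pds (hG : ContDiffOn ℝ (⊤ : ℕ∞) G {x | 0 < x.1}) :
    ContDiffOn ℝ (⊤ : ℕ∞) (pds G) {x | 0 < x.1} :=
  hG.fderiv_apply_const isOpen_halfPlane _

theorem ContDiffOn.pdt (hG : ContDiffOn ℝ (⊤ : ℕ∞) G {x | 0 < x.1}) :
    ContDiffOn ℝ (⊤ : ℕ∞) (pdt G) {x | 0 < x.1} :=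
  hG.fderiv_apply_const isOpen_halfPlane _

theorem pds_pdt_comm (hG : ContDiffOn ℝ (⊤ : ℕ∞) G {x | 0 < x.1}) :
    Set.EqOn (pds (pdt G)) (pdt (pds G)) {x | 0 < x.1} :=
  fun _ hx => hG.fderiv_fderiv_comm isOpen_halfPlane _ _ hx

theorem pdt_congr {F : ℝ × ℝ → ℝ} (h : Set.EqOn F G {x | 0 < x.1}) :
    Set.EqOn (pdt F) (pdt G) {x | 0 < x.1} := fun x hx => by
  rw [pdt, pdt, (h.eventuallyEq_of_mem (isOpen_halfPlane.mem_nhds hx)).fderiv_eq]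

/-- Euler's relations for the derivatives of a function homogeneous of degree two. -/
theorem IsHomogeneousOn.second_third_partials (h : IsHomogeneousOn G {x | 0 < x.1} 2)
    (hG : ContDiffOn ℝ (⊤ : ℕ∞) G {x | 0 < x.1}) {x : ℝ × ℝ} (hx : 0 < x.1) :
    pds (pds G) x = (pds G x - x.2 * pdt (pds G) x) / x.1 ∧
    pds (pdt (pdt G)) x = -(x.2 / x.1) * pdt (pdt (pdt G)) x ∧
    pdt (pdt (pds G)) x = -(x.2 / x.1) * pdt (pdt (pdt G)) x ∧
    pds (pdt (pds G)) x = (x.2 / x.1) ^ 2 * pdt (pdt (pdt G)) x ∧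
    pdt (pds (pds G)) x = (x.2 / x.1) ^ 2 * pdt (pdt (pdt G)) x ∧
    pds (pds (pds G)) x = -(x.2 / x.1) ^ 3 * pdt (pdt (pdt G)) x := by
  have hs : IsHomogeneousOn (_root_.pds G) {x | 0 < x.1} 1 :=
    h.fderiv_apply hG isOpen_halfPlane smul_mem_halfPlane _
  have ht : IsHomogeneousOn (_root_.pdt G) {x | 0 < x.1} 1 :=
    h.fderiv_apply hG isOpen_halfPlane smul_mem_halfPlane _
  have hss : IsHomogeneousOn (_root_.pds (_root_.pds G)) {x | 0 < x.1} 0 :=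
    hs.fderiv_apply hG.pds isOpen_halfPlane smul_mem_halfPlane _
  have hst : IsHomogeneousOn (_root_.pdt (_root_.pds G)) {x | 0 < x.1} 0 :=
    hs.fderiv_apply hG.pds isOpen_halfPlane smul_mem_halfPlane _
  have htt : IsHomogeneousOn (_root_.pdt (_root_.pdt G)) {x | 0 < x.1} 0 :=
    ht.fderiv_apply hG.pdt isOpen_halfPlane smul_mem_halfPlane _
  have e1 := hs.pds_add_pdt hG.pds hx
  have e2 := hss.pds_add_pdt hG.pds.pds hx
  have e3 := hst.pds_add_pdt hG.pds.pdt hx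
  have e4 := htt.pds_add_pdt hG.pdt.pdt hx
  have c1 : _root_.pds (_root_.pdt (_root_.pds G)) x = _root_.pdt (_root_.pds (_root_.pds G)) x :=
    pds_pdt_comm hG.pds hx
  have c2 : _root_.pdt (_root_.pdt (_root_.pds G)) x = _root_.pds (_root_.pdt (_root_.pdt G)) x :=
    (pdt_congr (pds_pdt_comm hG) hx).symm.trans (pds_pdt_comm hG.pdt hx).symm
  have hne := hx.ne'
  simp only [Int.cast_zero, zero_mul, Int.cast_one, one_mul] at e1 e2 e3 e4
  have f1 : _root_.pds (_root_.pdt (_root_.pdt G)) x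
      = -(x.2 / x.1) * _root_.pdt (_root_.pdt (_root_.pdt G)) x := by
    field_simp; linarith
  have f2 : _root_.pds (_root_.pdt (_root_.pds G)) x
      = (x.2 / x.1) ^ 2 * _root_.pdt (_root_.pdt (_root_.pdt G)) x := by
    rw [c2, f1] at e3
    field_simp at e3 ⊢; linarith
  refine ⟨?_, f1, c2.trans f1, f2, c1 ▸ f2, ?_⟩
  · field_simp; linarith
  · rw [← c1, f2] at e2
    field_simp at e2 ⊢; linarith

end HalfPlane

section Composition

variable {n : ℕ} {Ω : Set (Fin n → ℝ)} {L : (Fin n → ℝ) → ℝ} {G : ℝ × ℝ → ℝ}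

theorem basept_mem (hpos : ∀ y ∈ Ω, 0 < L y) (b : Fin n → ℝ) (σ : ℝ) {y : Fin n → ℝ}
    (hy : y ∈ Ω) : 0 < (basept L b σ y).1 :=
  mul_pos (exp_pos σ) (hpos y hy)

theorem hasDirDeriv_comp_basept (hΩ : IsOpen Ω) (hL : ContDiffOn ℝ (⊤ : ℕ∞) L Ω)
    (hpos : ∀ y ∈ Ω, 0 < L y) (hG : ContDiffOn ℝ (⊤ : ℕ∞) G {x | 0 < x.1})
    (b : Fin n → ℝ) (σ : ℝ) (i : Fin n) {y : Fin n → ℝ} (hy : y ∈ Ω) :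
    HasDirDeriv (fun z => G (basept L b σ z)) (Pi.single i 1) y
      (exp σ * pdi L i y * pds G (basept L b σ y) + b i * pdt G (basept L b σ y)) := by
  have hβ : HasFDerivAt (betaf b) (∑ j, b j • (ContinuousLinearMap.proj j : (Fin n → ℝ) →L[ℝ] ℝ)) y := by
    unfold betaf
    exact HasFDerivAt.fun_sum fun j _ => (hasFDerivAt_apply j y).const_mul (b j)
  have hB : HasFDerivAt (basept L b σ) _ y :=
    ((hL.hasDirDeriv hΩ 0 hy).1.hasFDerivAt.const_mul (exp σ)).prodMk hβ
  have h := (hG.hasDirDeriv isOpen_halfPlane 0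
    (basept_mem hpos b σ hy)).1.hasFDerivAt.comp y hB
  refine ⟨h.differentiableAt, ?_⟩
  have e : fderiv ℝ (fun z => G (basept L b σ z)) y = _ := h.fderiv
  rw [e, ContinuousLinearMap.comp_apply, fderiv_apply_eq_pds_add_pdt]
  simp [pdi, Pi.single_apply]

theorem pdi_comp_basept (hΩ : IsOpen Ω) (hL : ContDiffOn ℝ (⊤ : ℕ∞) L Ω)
    (hpos : ∀ y ∈ Ω, 0 < L y) (hG : ContDiffOn ℝ (⊤ : ℕ∞) G {x | 0 < x.1})
    (b : Fin n → ℝ) (σ : ℝ) (i : Fin n) :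
    Set.EqOn (pdi (fun z => G (basept L b σ z)) i)
      (fun z => exp σ * pdi L i z * pds G (basept L b σ z) + b i * pdt G (basept L b σ z)) Ω :=
  fun _ hy => (hasDirDeriv_comp_basept hΩ hL hpos hG b σ i hy).2

theorem pdi_pdi_comp_basept (hΩ : IsOpen Ω) (hL : ContDiffOn ℝ (⊤ : ℕ∞) L Ω)
    (hpos : ∀ y ∈ Ω, 0 < L y) (hG : ContDiffOn ℝ (⊤ : ℕ∞) G {x | 0 < x.1})
    (b : Fin n → ℝ) (σ : ℝ) (i j : Fin n) :
    Set.EqOn (pdi (pdi (fun z => G (basept L b σ z)) i) j)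
      (fun z => exp σ * pdi (pdi L i) j z * pds G (basept L b σ z)
        + exp σ * pdi L i z * (exp σ * pdi L j z * pds (pds G) (basept L b σ z)
          + b j * pdt (pds G) (basept L b σ z))
        + b i * (exp σ * pdi L j z * pdt (pds G) (basept L b σ z)
          + b j * pdt (pdt G) (basept L b σ z))) Ω := by
  intro y hy
  have hl := (hL.fderiv_apply_const hΩ (Pi.single i 1)).hasDirDeriv hΩ (Pi.single j 1) hy
  have h := ((hl.const_mul (exp σ)).mul
    (hasDirDeriv_comp_basept hΩ hL hpos hG.pds b σ j hy)).add
    ((hasDirDeriv_comp_basept hΩ hL hpos hG.pdt b σ j hy).const_mul (b i))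
  have e := h.fderiv_eq_of_eqOn hΩ (pdi_comp_basept hΩ hL hpos hG b σ i) hy
  rw [pds_pdt_comm hG (basept_mem hpos b σ hy)] at e
  exact e

theorem pdi_pdi_pdi_comp_basept (hΩ : IsOpen Ω) (hL : ContDiffOn ℝ (⊤ : ℕ∞) L Ω)
    (hpos : ∀ y ∈ Ω, 0 < L y) (hG : ContDiffOn ℝ (⊤ : ℕ∞) G {x | 0 < x.1})
    (b : Fin n → ℝ) (σ : ℝ) (i j k : Fin n) {y : Fin n → ℝ} (hy : y ∈ Ω) :
    pdi (pdi (pdi (fun z => G (basept L b σ z)) i) j) k y =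
      exp σ * pdi (pdi (pdi L i) j) k y * pds G (basept L b σ y)
      + exp σ * pdi (pdi L i) j y * (exp σ * pdi L k y * pds (pds G) (basept L b σ y)
          + b k * pdt (pds G) (basept L b σ y))
      + (exp σ * pdi (pdi L i) k y * (exp σ * pdi L j y * pds (pds G) (basept L b σ y)
          + b j * pdt (pds G) (basept L b σ y))
        + exp σ * pdi L i y * ((exp σ * pdi (pdi L j) k y * pds (pds G) (basept L b σ y)
            + exp σ * pdi L j y * (exp σ * pdi L k y * pds (pds (pds G)) (basept L b σ y)
              + b k * pdt (pds (pds G)) (basept L b σ y)))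
          + b j * (exp σ * pdi L k y * pds (pdt (pds G)) (basept L b σ y)
            + b k * pdt (pdt (pds G)) (basept L b σ y))))
      + b i * ((exp σ * pdi (pdi L j) k y * pdt (pds G) (basept L b σ y)
          + exp σ * pdi L j y * (exp σ * pdi L k y * pds (pdt (pds G)) (basept L b σ y)
            + b k * pdt (pdt (pds G)) (basept L b σ y)))
        + b j * (exp σ * pdi L k y * pds (pdt (pdt G)) (basept L b σ y)
          + b k * pdt (pdt (pdt G)) (basept L b σ y))) := by
  have h1 (a : Fin n) := hL.fderiv_apply_const hΩ (Pi.single a 1)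
  have l1 (a : Fin n) := ((h1 a).hasDirDeriv hΩ (Pi.single k 1) hy).const_mul (exp σ)
  have l2 := (((h1 i).fderiv_apply_const hΩ (Pi.single j 1)).hasDirDeriv hΩ
    (Pi.single k 1) hy).const_mul (exp σ)
  have hc {F : ℝ × ℝ → ℝ} (hF : ContDiffOn ℝ (⊤ : ℕ∞) F {x | 0 < x.1}) :=
    hasDirDeriv_comp_basept hΩ hL hpos hF b σ k hy
  have h := ((l2.mul (hc hG.pds)).add
    ((l1 i).mul (((l1 j).mul (hc hG.pds.pds)).add ((hc hG.pds.pdt).const_mul (b j))))).add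
    ((((l1 j).mul (hc hG.pds.pdt)).add ((hc hG.pdt.pdt).const_mul (b j))).const_mul (b i))
  exact h.fderiv_eq_of_eqOn hΩ (pdi_pdi_comp_basept hΩ hL hpos hG b σ i j) hy

end Composition

section ConformalChange

variable {n : ℕ} {Ω : Set (Fin n → ℝ)} {L : (Fin n → ℝ) → ℝ} {f : ℝ × ℝ → ℝ}

theorem pdt_half_sq (hf : ContDiffOn ℝ (⊤ : ℕ∞) f {x : ℝ × ℝ | 0 < x.1}) :
    Set.EqOn (pdt fun x => 1 / 2 * f x ^ 2) (fun x => f x * pdt f x) {x | 0 < x.1} := by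
  intro x hx
  have h := hf.hasDirDeriv isOpen_halfPlane (0, 1) hx
  exact ((h.mul h).const_mul (1 / 2)).fderiv_eq_of_eqOn isOpen_halfPlane
    (fun z _ => by simp only [sq]) hx |>.trans (by simp only [pdt]; ring)

theorem pds_half_sq (hf : ContDiffOn ℝ (⊤ : ℕ∞) f {x : ℝ × ℝ | 0 < x.1}) :
    Set.EqOn (pds fun x => 1 / 2 * f x ^ 2) (fun x => f x * pds f x) {x | 0 < x.1} := by
  intro x hx
  have h := hf.hasDirDeriv isOpen_halfPlane (1, 0) hx
  exact ((h.mul h).const_mul (1 / 2)).fderiv_eq_of_eqOn isOpen_halfPlane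
    (fun z _ => by simp only [sq]) hx |>.trans (by simp only [pds]; ring)

theorem pdt_pds_half_sq (hf : ContDiffOn ℝ (⊤ : ℕ∞) f {x : ℝ × ℝ | 0 < x.1}) :
    Set.EqOn (pdt (pds fun x => 1 / 2 * f x ^ 2))
      (fun x => pdt f x * pds f x + f x * pdt (pds f) x) {x | 0 < x.1} := fun _ hx =>
  ((hf.hasDirDeriv isOpen_halfPlane _ hx).mul
    (hf.pds.hasDirDeriv isOpen_halfPlane _ hx)).fderiv_eq_of_eqOn isOpen_halfPlane
      (pds_half_sq hf) hx

theorem pdt_pdt_half_sq (hf : ContDiffOn ℝ (⊤ : ℕ∞) f {x : ℝ × ℝ | 0 < x.1}) :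
    Set.EqOn (pdt (pdt fun x => 1 / 2 * f x ^ 2))
      (fun x => pdt f x ^ 2 + f x * pdt (pdt f) x) {x | 0 < x.1} := fun _ hx =>
  ((hf.hasDirDeriv isOpen_halfPlane _ hx).mul
    (hf.pdt.hasDirDeriv isOpen_halfPlane _ hx)).fderiv_eq_of_eqOn isOpen_halfPlane
      (pdt_half_sq hf) hx |>.trans (by simp only [pdt]; ring)

/-- The Cartan tensor of the transformed Finsler function. -/
theorem cartan_Lbar (hΩ : IsOpen Ω) (hcone : ∀ c : ℝ, 0 < c → ∀ x ∈ Ω, c • x ∈ Ω)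
    (hL : ContDiffOn ℝ (⊤ : ℕ∞) L Ω) (hpos : ∀ y ∈ Ω, 0 < L y)
    (hhom : IsHomogeneousOn L Ω 1) (b : Fin n → ℝ) (σ : ℝ)
    (hf : ContDiffOn ℝ (⊤ : ℕ∞) f {x : ℝ × ℝ | 0 < x.1})
    (hfpos : ∀ x : ℝ × ℝ, 0 < x.1 → 0 < f x)
    (hfhom : IsHomogeneousOn f {x : ℝ × ℝ | 0 < x.1} 1)
    {y : Fin n → ℝ} (hy : y ∈ Ω) (i j k : Fin n) :
    cartan (Lbar f L b σ) y i j k =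
      exp σ * pfun f L b σ y * cartan L y i j k
      + exp σ * pm1fun f L b σ y / 2 * (hmet L y i j * mvec L b y k
        + hmet L y i k * mvec L b y j + hmet L y j k * mvec L b y i)
      + p02fun f L b σ y / 2 * (mvec L b y i * mvec L b y j * mvec L b y k) := by
  have hx : 0 < (basept L b σ y).1 := basept_mem hpos b σ hy
  have hLne := (hpos y hy).ne'
  have hfne := (hfpos _ hx).ne'
  have hE := (exp_pos σ).ne'
  have hG : ContDiffOn ℝ (⊤ : ℕ∞) (fun x => 1 / 2 * f x ^ 2) {x : ℝ × ℝ | 0 < x.1} :=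
    contDiffOn_const.mul (hf.pow 2)
  have hGhom : IsHomogeneousOn (fun x => 1 / 2 * f x ^ 2) {x : ℝ × ℝ | 0 < x.1} 2 := by
    intro c hc x hx
    simp only [hfhom.sq c hc x hx]
    ring
  have hp : pfun f L b σ y = pds (fun x => 1 / 2 * f x ^ 2) (basept L b σ y) / L y := by
    rw [pds_half_sq hf hx, pfun]
  have hpm1 : pm1fun f L b σ y
      = pdt (pds fun x => 1 / 2 * f x ^ 2) (basept L b σ y) / L y := by
    rw [pdt_pds_half_sq hf hx, pm1fun, qm1fun, pfun]
    field_simp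
    ring
  have hp02 : p02fun f L b σ y
      = pdt (pdt (pdt fun x => 1 / 2 * f x ^ 2)) (basept L b σ y) := by
    rw [pdt_congr (pdt_pdt_half_sq hf) hx, p02fun]
  have hc : cartan (Lbar f L b σ) y i j k = 1 / 2 *
      pdi (pdi (pdi (fun z => 1 / 2 * f (basept L b σ z) ^ 2) i) j) k y := by
    have e (F : (Fin n → ℝ) → ℝ) (c : ℝ) (a : Fin n) :
        pdi (fun z => c * F z) a = fun z => c * pdi F a z := by
      funext z
      exact DFunLike.congr_fun (congrFun (fderiv_const_smul_field (𝕜 := ℝ) (f := F) c) z)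
        (Pi.single a 1)
    simp only [cartan, Lbar, e]
    ring
  obtain ⟨e1, e2, e3, e4, e5, e6⟩ := hGhom.second_third_partials hG hx
  rw [hc, pdi_pdi_pdi_comp_basept hΩ hL hpos hG b σ i j k hy, hp, hpm1, hp02,
    cartan_eq hΩ hL hy, e1, e2, e3, e4, e5, e6]
  simp only [hmet_eq hΩ hL hy, mvec_eq hΩ hcone hL hpos hhom b hy]
  rw [show (basept L b σ y).1 = exp σ * L y from rfl,
    show (basept L b σ y).2 = betaf b y from rfl]
  field_simp
  ring

end ConformalChange

section Contraction

variable {n : ℕ} {Ω : Set (Fin n → ℝ)} {L : (Fin n → ℝ) → ℝ}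
  {ginv : (Fin n → ℝ) → Fin n → Fin n → ℝ} {y : Fin n → ℝ}

theorem sum_bup_mul_gmet (hΩ : IsOpen Ω) (hL : ContDiffOn ℝ (⊤ : ℕ∞) L Ω) (hy : y ∈ Ω)
    (hginv' : ∀ i j : Fin n,
      ∑ r, gmet L y i r * ginv y r j = if i = j then (1 : ℝ) else 0)
    (b : Fin n → ℝ) (i : Fin n) : ∑ r, bup ginv b y r * gmet L y r i = b i := by
  simp only [bup, Finset.sum_mul]
  rw [Finset.sum_comm]
  have h (s : Fin n) : ∑ r, ginv y r s * b s * gmet L y r i = b s * if i = s then 1 else 0 := by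
    rw [← hginv', Finset.mul_sum]
    refine Finset.sum_congr rfl fun r _ => ?_
    rw [gmet_comm hΩ hL hy r i]
    ring
  simp [h]

theorem sum_bup_mul_lvec (hΩ : IsOpen Ω) (hcone : ∀ c : ℝ, 0 < c → ∀ x ∈ Ω, c • x ∈ Ω)
    (hL : ContDiffOn ℝ (⊤ : ℕ∞) L Ω) (hpos : ∀ y ∈ Ω, 0 < L y)
    (hhom : IsHomogeneousOn L Ω 1) (hy : y ∈ Ω)
    (hginv' : ∀ i j : Fin n,
      ∑ r, gmet L y i r * ginv y r j = if i = j then (1 : ℝ) else 0)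
    (b : Fin n → ℝ) : ∑ r, bup ginv b y r * lvec L y r = betaf b y / L y := by
  rw [eq_div_iff (hpos y hy).ne', betaf, Finset.sum_mul]
  have h (r : Fin n) : bup ginv b y r * lvec L y r * L y
      = ∑ i, bup ginv b y r * gmet L y r i * y i := by
    have := ylow_eq hΩ hcone hL hhom hy r
    simp only [mul_assoc, ← Finset.mul_sum]
    rw [← ylow, this, lvec, mul_comm (L y)]
  simp only [h]
  rw [Finset.sum_comm]
  simp only [← Finset.sum_mul, sum_bup_mul_gmet hΩ hL hy hginv' b]

theorem sum_bup_mul_hmet (hΩ : IsOpen Ω) (hcone : ∀ c : ℝ, 0 < c → ∀ x ∈ Ω, c • x ∈ Ω)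
    (hL : ContDiffOn ℝ (⊤ : ℕ∞) L Ω) (hpos : ∀ y ∈ Ω, 0 < L y)
    (hhom : IsHomogeneousOn L Ω 1) (hy : y ∈ Ω)
    (hginv' : ∀ i j : Fin n,
      ∑ r, gmet L y i r * ginv y r j = if i = j then (1 : ℝ) else 0)
    (b : Fin n → ℝ) (i : Fin n) : ∑ r, bup ginv b y r * hmet L y r i = mvec L b y i := by
  simp only [hmet, mul_sub, Finset.sum_sub_distrib, ← mul_assoc, ← Finset.sum_mul]
  rw [sum_bup_mul_gmet hΩ hL hy hginv', sum_bup_mul_lvec hΩ hcone hL hpos hhom hy hginv',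
    mvec_eq hΩ hcone hL hpos hhom b hy, lvec]

theorem mup_eq (hginv : ∀ i j : Fin n,
      ∑ r, ginv y i r * gmet L y r j = if i = j then (1 : ℝ) else 0)
    (b : Fin n → ℝ) (i : Fin n) :
    mup L ginv b y i = bup ginv b y i - betaf b y / L y ^ 2 * y i := by
  have h : ∑ j, ginv y i j * ylow L y j = y i := by
    simp only [ylow, Finset.mul_sum, ← mul_assoc]
    rw [Finset.sum_comm]
    simp [← Finset.sum_mul, hginv]
  simp only [mup, mvec, mul_sub, Finset.sum_sub_distrib, mul_left_comm (ginv y i _),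
    ← Finset.mul_sum, h, bup]

theorem sum_bup_mul_mvec (hΩ : IsOpen Ω) (hcone : ∀ c : ℝ, 0 < c → ∀ x ∈ Ω, c • x ∈ Ω)
    (hL : ContDiffOn ℝ (⊤ : ℕ∞) L Ω) (hpos : ∀ y ∈ Ω, 0 < L y)
    (hhom : IsHomogeneousOn L Ω 1) (hy : y ∈ Ω)
    (hginv : ∀ i j : Fin n,
      ∑ r, ginv y i r * gmet L y r j = if i = j then (1 : ℝ) else 0)
    (b : Fin n → ℝ) : ∑ r, bup ginv b y r * mvec L b y r = msq L ginv b y := by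
  have h (r : Fin n) : ∑ j, ginv y r j * mvec L b y r * mvec L b y j
      = bup ginv b y r * mvec L b y r - betaf b y / L y ^ 2 * (mvec L b y r * y r) := by
    have := mup_eq hginv b r
    rw [mup] at this
    simp only [mul_right_comm _ (mvec L b y r), ← Finset.sum_mul, this]
    ring
  simp only [msq, h, Finset.sum_sub_distrib, ← Finset.mul_sum,
    sum_mvec_mul hΩ hcone hL hpos hhom b hy, mul_zero, sub_zero]

end Contraction

theorem stmt_19
    (n : ℕ) (Ω : Set (Fin n → ℝ)) (hΩopen : IsOpen Ω)
    (hΩ0 : ∀ y ∈ Ω, y ≠ 0)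
    (hΩcone : ∀ lam : ℝ, 0 < lam → ∀ y ∈ Ω, lam • y ∈ Ω)
    (L : (Fin n → ℝ) → ℝ)
    (hLsmooth : ContDiffOn ℝ (⊤ : ℕ∞) L Ω)
    (hLpos : ∀ y ∈ Ω, 0 < L y)
    (hLhom : ∀ lam : ℝ, 0 < lam → ∀ y ∈ Ω, L (lam • y) = lam * L y)
    (ginv : (Fin n → ℝ) → Fin n → Fin n → ℝ)
    (hginv : ∀ y ∈ Ω, ∀ i j : Fin n,
      ∑ r, ginv y i r * gmet L y r j = if i = j then (1 : ℝ) else 0)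
    (hginv' : ∀ y ∈ Ω, ∀ i j : Fin n,
      ∑ r, gmet L y i r * ginv y r j = if i = j then (1 : ℝ) else 0)
    (b : Fin n → ℝ) (σ : ℝ)
    (f : ℝ × ℝ → ℝ)
    (hf : ContDiffOn ℝ (⊤ : ℕ∞) f {x : ℝ × ℝ | 0 < x.1})
    (hfpos : ∀ x : ℝ × ℝ, 0 < x.1 → 0 < f x)
    (hfhom : ∀ lam : ℝ, 0 < lam → ∀ x : ℝ × ℝ, 0 < x.1 →
      f (lam * x.1, lam * x.2) = lam * f x)
    (hp : ∀ y ∈ Ω, pfun f L b σ y ≠ 0)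
    (hβ : ∀ y ∈ Ω, betaf b y ≠ 0)
    (hε : ∀ y ∈ Ω, epsfun f L ginv b σ y ≠ 0)
    :
    ∀ y ∈ Ω, ∀ l i j : Fin n,
      ∑ r, gbarinv f L ginv b σ y l r * cartan (Lbar f L b σ) y r i j
        = (∑ r, ginv y l r * cartan L y r i j)
          + ((1 / (2 * pfun f L b σ y)) *
              (Real.exp (-σ) * mup L ginv b y l
                - pfun f L b σ y * msq L ginv b y *
                    (s0fun f L ginv b σ y * bup ginv b y l + sm1fun f L ginv b σ y * y l)) *
              (Real.exp σ * pm1fun f L b σ y * hmet L y i j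
                + p02fun f L b σ y * mvec L b y i * mvec L b y j)
            - Real.exp σ *
                (s0fun f L ginv b σ y * bup ginv b y l + sm1fun f L ginv b σ y * y l) *
                (pfun f L b σ y * (∑ s, cartan L y i s j * bup ginv b y s)
                  + pm1fun f L b σ y * mvec L b y i * mvec L b y j)
            + pm1fun f L b σ y / (2 * pfun f L b σ y) *
                (hup L ginv y l i * mvec L b y j + hup L ginv y l j * mvec L b y i)) := by
  intro y hy l i j
  have hhom : IsHomogeneousOn L Ω 1 := fun c hc x hx => by rw [hLhom c hc x hx, zpow_one]
  have hfhom' : IsHomogeneousOn f {x : ℝ × ℝ | 0 < x.1} 1 := fun c hc x hx => by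
    rw [zpow_one, ← hfhom c hc x hx]; rfl
  have hpne := hp y hy
  have hE := (exp_pos σ).ne'
  have hcontr (w : Fin n → ℝ) : ∑ r, w r * cartan (Lbar f L b σ) y r i j
      = exp σ * pfun f L b σ y * ∑ r, w r * cartan L y r i j
        + exp σ * pm1fun f L b σ y / 2 * ((∑ r, w r * hmet L y r i) * mvec L b y j
          + (∑ r, w r * hmet L y r j) * mvec L b y i
          + hmet L y i j * ∑ r, w r * mvec L b y r)
        + p02fun f L b σ y / 2 * (∑ r, w r * mvec L b y r) * (mvec L b y i * mvec L b y j) := by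
    simp only [cartan_Lbar hΩopen hΩcone hLsmooth hLpos hhom b σ hf hfpos hfhom' hy,
      Finset.mul_sum, Finset.sum_mul, ← Finset.sum_add_distrib]
    refine Finset.sum_congr rfl fun r _ => ?_
    ring
  have hysum : ∑ r, y r * cartan (Lbar f L b σ) y r i j = 0 := by
    have h1 : ∑ r, y r * cartan L y r i j = 0 := by
      rw [← sum_cartan_mul hΩopen hΩcone hLsmooth hhom hy i j]
      refine Finset.sum_congr rfl fun r _ => ?_
      rw [cartan_comm_left hΩopen hLsmooth hy, cartan_comm_right hΩopen hLsmooth hy, mul_comm]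
    have h2 (a : Fin n) : ∑ r, y r * hmet L y r a = 0 := by
      rw [← sum_hmet_mul hΩopen hΩcone hLsmooth hhom hy a]
      refine Finset.sum_congr rfl fun r _ => ?_
      rw [hmet_comm hΩopen hLsmooth hy, mul_comm]
    have h3 : ∑ r, y r * mvec L b y r = 0 := by
      simpa only [mul_comm] using sum_mvec_mul hΩopen hΩcone hLsmooth hLpos hhom b hy
    rw [hcontr, h1, h2, h2, h3]
    ring
  have hbsum := hcontr (bup ginv b y)
  have hC : ∑ r, bup ginv b y r * cartan L y r i j = ∑ s, cartan L y i s j * bup ginv b y s :=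
    Finset.sum_congr rfl fun r _ => by rw [cartan_comm_left hΩopen hLsmooth hy, mul_comm]
  rw [sum_bup_mul_hmet hΩopen hΩcone hLsmooth hLpos hhom hy (hginv' y hy),
    sum_bup_mul_hmet hΩopen hΩcone hLsmooth hLpos hhom hy (hginv' y hy),
    sum_bup_mul_mvec hΩopen hΩcone hLsmooth hLpos hhom hy (hginv y hy), hC] at hbsum
  have hgsum := hcontr (ginv y l)
  rw [← hup, ← hup, ← mup] at hgsum
  have hsplit : ∑ r, gbarinv f L ginv b σ y l r * cartan (Lbar f L b σ) y r i j
      = exp (-σ) / pfun f L b σ y * ∑ r, ginv y l r * cartan (Lbar f L b σ) y r i j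
        - (s0fun f L ginv b σ y * bup ginv b y l + sm1fun f L ginv b σ y * y l)
          * ∑ r, bup ginv b y r * cartan (Lbar f L b σ) y r i j
        - (sm1fun f L ginv b σ y * bup ginv b y l + sm2fun f L ginv b σ y * y l)
          * ∑ r, y r * cartan (Lbar f L b σ) y r i j := by
    simp only [Finset.mul_sum, ← Finset.sum_sub_distrib]
    refine Finset.sum_congr rfl fun r _ => ?_
    rw [gbarinv]
    ring
  rw [hsplit, hysum, hbsum, hgsum, exp_neg]
  field_simp
  ring
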